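/- Let t₀ > 0, α > 3, and c > 0. Let H be a real Hilbert space, f : H → ℝ convex and differentiable with ∇f Lipschitz continuous on bounded sets, and argmin f nonempty. Let x : [t₀, ∞) → H be a twice differentiable solution of ẍ(t) + (α/t) ẋ(t) + ∇f(x(t)) + (c/t²) x(t) = 0 on [t₀, ∞). Then: (a) f(x(t)) − min f = O(1/t²) as t → ∞; (b) the trajectory x is bounded on [t₀, ∞); and (c) ‖ẋ(t)‖ = O(1/t) as t → ∞. -/

import Mathlib

open Filter Set

/-- First-order (gradient) inequality for a differentiable convex function. -/
theorem ConvexOn.sub_le_inner_of_hasGradientAt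
    {H : Type*} [NormedAddCommGroup H] [InnerProductSpace ℝ H] [CompleteSpace H]
    {f : H → ℝ} (hconv : ConvexOn ℝ Set.univ f) {g y : H} (hg : HasGradientAt f g y) (z : H) :
    f y - f z ≤ inner ℝ g (y - z) := by
  have hline : HasDerivAt (fun s : ℝ => y + s • (z - y)) (z - y) 0 := by
    simpa using ((hasDerivAt_id (0 : ℝ)).smul_const (z - y)).const_add y
  have hg' : HasFDerivAt f (InnerProductSpace.toDual ℝ H g) (y + (0 : ℝ) • (z - y)) := by
    simpa using hg.hasFDerivAt
  have hd : HasDerivAt (fun s : ℝ => f (y + s • (z - y))) (inner ℝ g (z - y)) 0 := by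
    simpa [Function.comp_def] using hg'.comp_hasDerivAt (0 : ℝ) hline
  have hc : ConvexOn ℝ Set.univ (fun s : ℝ => f (y + s • (z - y))) := by
    have := hconv.comp_affineMap (AffineMap.lineMap y z : ℝ →ᵃ[ℝ] H)
    simpa [Function.comp_def, AffineMap.lineMap_apply, add_comm] using this
  have h := hc.le_slope_of_hasDerivAt (mem_univ 0) (mem_univ 1) one_pos hd
  simp only [slope_def_field, one_smul, zero_smul, add_zero, sub_zero, div_one,
    add_sub_cancel] at h
  rw [← neg_sub z y, inner_neg_right]
  linarith

/-- A function with `t * E' t ≤ M - κ * E t` on `[t₀, ∞)` is bounded above there. -/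
theorem bddAbove_of_mul_deriv_le {E E' : ℝ → ℝ} {t₀ κ M : ℝ} (ht₀ : 0 < t₀) (hκ : 0 < κ)
    (hE : ∀ t, t₀ ≤ t → HasDerivAt E (E' t) t)
    (hE' : ∀ t, t₀ ≤ t → t * E' t + κ * E t ≤ M) :
    ∃ K > 0, ∀ t, t₀ ≤ t → E t ≤ K := by
  have hG : ∀ t, t₀ ≤ t → HasDerivAt (fun s : ℝ => s ^ κ * (E s - M / κ))
      (κ * t ^ (κ - 1) * (E t - M / κ) + t ^ κ * E' t) t := fun t ht =>
    (Real.hasDerivAt_rpow_const (Or.inl (ht₀.trans_le ht).ne')).mul ((hE t ht).sub_const _)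
  have hanti : AntitoneOn (fun s : ℝ => s ^ κ * (E s - M / κ)) (Ici t₀) := by
    refine antitoneOn_of_deriv_nonpos (convex_Ici t₀)
      (fun t ht => (hG t ht).continuousAt.continuousWithinAt)
      (fun t ht => (hG t (interior_subset ht)).differentiableAt.differentiableWithinAt) ?_
    intro t ht
    have ht' : t₀ ≤ t := interior_subset ht
    have htpos : 0 < t := ht₀.trans_le ht'
    rw [(hG t ht').deriv]
    have hpow : t ^ κ = t ^ (κ - 1) * t := by
      rw [← Real.rpow_add_one htpos.ne']; simp
    have hfac : κ * t ^ (κ - 1) * (E t - M / κ) + t ^ κ * E' t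
        = t ^ (κ - 1) * (t * E' t + κ * E t - M) := by
      rw [hpow]; field_simp; ring
    rw [hfac]
    exact mul_nonpos_of_nonneg_of_nonpos (by positivity) (by linarith [hE' t ht'])
  refine ⟨|E t₀ - M / κ| + |M / κ| + 1, by positivity, fun t ht => ?_⟩
  have htpos : 0 < t := ht₀.trans_le ht
  have h1 : t ^ κ * (E t - M / κ) ≤ t₀ ^ κ * (E t₀ - M / κ) :=
    hanti (mem_Ici.2 le_rfl) (mem_Ici.2 ht) ht
  have h2 : t₀ ^ κ * (E t₀ - M / κ) ≤ t ^ κ * |E t₀ - M / κ| := by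
    have := Real.rpow_le_rpow ht₀.le ht hκ.le
    exact (mul_le_mul_of_nonneg_left (le_abs_self _) (by positivity)).trans
      (mul_le_mul_of_nonneg_right this (abs_nonneg _))
  have h3 := le_of_mul_le_mul_left (h1.trans h2) (Real.rpow_pos_of_pos htpos κ)
  linarith [le_abs_self (M / κ)]

/-- Decay estimate for the Lyapunov function of the Tikhonov-regularized inertial dynamics,
written for the position `a + z`, velocity `p`, acceleration `q` and gradient `g` at time `t`;
`φ` is the gap in function value. -/
theorem lyapunov_decay {H : Type*} [NormedAddCommGroup H] [InnerProductSpace ℝ H]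
    {α c t l κ φ : ℝ} {a z p q g : H} (ht : 0 < t) (hc : 0 < c) (hl : 0 < l)
    (hφ : 0 ≤ φ) (hκ0 : 0 ≤ κ) (hκ1 : κ ≤ l - 2) (hκ2 : κ ≤ α - 1 - l)
    (hκ3 : κ * (2 * l ^ 2 + l * (α - 1 - l)) ≤ l * c)
    (hconv : φ ≤ inner ℝ g a)
    (hode : q + (α / t) • p + g + (c / t ^ 2) • (a + z) = 0) :
    t * (2 * t * φ + t ^ 2 * inner ℝ g p + c * inner ℝ (a + z) p
        + inner ℝ (l • a + t • p) (l • p + (p + t • q)) + l * (α - 1 - l) * inner ℝ a p)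
      + κ * (t ^ 2 * φ + c / 2 * ‖a + z‖ ^ 2 + 1 / 2 * ‖l • a + t • p‖ ^ 2
        + l * (α - 1 - l) / 2 * ‖a‖ ^ 2) ≤ l * c / 2 * ‖z‖ ^ 2 := by
  have hq : q = -((α / t) • p + g + (c / t ^ 2) • (a + z)) := by
    rw [eq_neg_iff_add_eq_zero, ← hode]; abel
  have hw : t • (l • p + (p + t • q)) = (t * (l + 1 - α)) • p - t ^ 2 • g - c • (a + z) := by
    rw [hq]
    match_scalars <;> field_simp
    ring
  have hin : t * inner ℝ (l • a + t • p) (l • p + (p + t • q))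
      = inner ℝ (l • a + t • p) ((t * (l + 1 - α)) • p - t ^ 2 • g - c • (a + z)) := by
    rw [← hw, inner_smul_right]
  have hv : ‖l • a + t • p‖ ^ 2 ≤ 2 * l ^ 2 * ‖a‖ ^ 2 + 2 * t ^ 2 * ‖p‖ ^ 2 := by
    have h := sq_nonneg ‖l • a - t • p‖
    rw [norm_sub_sq_real] at h
    rw [norm_add_sq_real]
    simp only [norm_smul, mul_pow, Real.norm_eq_abs, sq_abs] at h ⊢
    linarith
  have hx : ‖a + z‖ ^ 2 = ‖a‖ ^ 2 + 2 * inner ℝ a z + ‖z‖ ^ 2 := norm_add_sq_real a z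
  have e1 : t * (2 * t * φ + t ^ 2 * inner ℝ g p + c * inner ℝ (a + z) p
        + inner ℝ (l • a + t • p) (l • p + (p + t • q)) + l * (α - 1 - l) * inner ℝ a p)
      = 2 * t ^ 2 * φ - l * t ^ 2 * inner ℝ g a - (α - 1 - l) * t ^ 2 * ‖p‖ ^ 2
        - l * c / 2 * (‖a + z‖ ^ 2 + ‖a‖ ^ 2 - ‖z‖ ^ 2) := by
    rw [mul_add, mul_add t _ (inner ℝ (l • a + t • p) _), hin, hx]
    simp only [inner_add_left, inner_add_right, inner_sub_right, real_inner_smul_left,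
      real_inner_smul_right, real_inner_self_eq_norm_sq, real_inner_comm a g, real_inner_comm p g,
      real_inner_comm p a, real_inner_comm p z]
    ring
  rw [e1]
  have i1 : κ * (1 / 2 * ‖l • a + t • p‖ ^ 2) ≤
      κ * (1 / 2 * (2 * l ^ 2 * ‖a‖ ^ 2 + 2 * t ^ 2 * ‖p‖ ^ 2)) := by gcongr
  have i2 : l * t ^ 2 * φ ≤ l * t ^ 2 * inner ℝ g a := by gcongr
  have i3 : κ * (t ^ 2 * φ) ≤ (l - 2) * (t ^ 2 * φ) := by gcongr
  have i4 : κ * (t ^ 2 * ‖p‖ ^ 2) ≤ (α - 1 - l) * (t ^ 2 * ‖p‖ ^ 2) := by gcongr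
  have i5 : κ * (c / 2 * ‖a + z‖ ^ 2) ≤ l * (c / 2 * ‖a + z‖ ^ 2) := by
    gcongr; linarith
  have i6 := mul_le_mul_of_nonneg_right hκ3 (sq_nonneg ‖a‖)
  nlinarith [i1, i2, i3, i4, i5, i6]

/-- For `α > 3`: `O(1/t²)` values, bounded trajectory, and `‖ẋ(t)‖ = O(1/t)`
(Theorem 3.1 (ii)). -/
theorem trigs_critical_value_rate_boundedness_velocity
    {H : Type*} [NormedAddCommGroup H] [InnerProductSpace ℝ H] [CompleteSpace H]
    (f : H → ℝ) (f' : H → H)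
    (hconv : ConvexOn ℝ Set.univ f)
    (hgrad : ∀ y, HasGradientAt f (f' y) y)
    (hlip : ∀ s : Set H, Bornology.IsBounded s → ∃ L : NNReal, LipschitzOnWith L f' s)
    (xbar : H) (hmin : ∀ y, f xbar ≤ f y)
    (α c t₀ : ℝ) (hα : 3 < α) (hc : 0 < c) (ht₀ : 0 < t₀)
    (x x' x'' : ℝ → H)
    (hx1 : ∀ t, t₀ ≤ t → HasDerivAt x (x' t) t)
    (hx2 : ∀ t, t₀ ≤ t → HasDerivAt x' (x'' t) t)
    (hode : ∀ t, t₀ ≤ t →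
      x'' t + (α / t) • x' t + f' (x t) + (c / t ^ 2) • x t = 0) :
    (∃ C > 0, ∃ T, t₀ ≤ T ∧ ∀ t, T ≤ t → f (x t) - f xbar ≤ C / t ^ 2) ∧
    Bornology.IsBounded (x '' Set.Ici t₀) ∧
    (∃ C > 0, ∃ T, t₀ ≤ T ∧ ∀ t, T ≤ t → ‖x' t‖ ≤ C / t) := by
  obtain ⟨l, hl⟩ : ∃ l, l = (α + 1) / 2 := ⟨_, rfl⟩
  have hl0 : 0 < l := by linarith
  have hl2 : 0 < l - 2 := by linarith
  have hl1 : 0 < α - 1 - l := by linarith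
  have hξ : 0 < l * (α - 1 - l) := mul_pos hl0 hl1
  have hD : 0 < 2 * l ^ 2 + l * (α - 1 - l) := by positivity
  obtain ⟨κ, hκ⟩ : ∃ κ, κ = min (l - 2) (l * c / (2 * l ^ 2 + l * (α - 1 - l))) := ⟨_, rfl⟩
  have hκ0 : 0 < κ := hκ ▸ lt_min hl2 (by positivity)
  have hκ1 : κ ≤ l - 2 := hκ ▸ min_le_left _ _
  have hκ3 : κ * (2 * l ^ 2 + l * (α - 1 - l)) ≤ l * c :=
    (le_div_iff₀ hD).1 (hκ ▸ min_le_right _ _)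
  obtain ⟨K, hK, hEK⟩ := bddAbove_of_mul_deriv_le (M := l * c / 2 * ‖xbar‖ ^ 2)
    (E := fun t => t ^ 2 * (f (x t) - f xbar) + c / 2 * ‖x t‖ ^ 2
      + 1 / 2 * ‖l • (x t - xbar) + t • x' t‖ ^ 2 + l * (α - 1 - l) / 2 * ‖x t - xbar‖ ^ 2)
    (E' := fun t => 2 * t * (f (x t) - f xbar) + t ^ 2 * inner ℝ (f' (x t)) (x' t)
      + c * inner ℝ (x t) (x' t)
      + inner ℝ (l • (x t - xbar) + t • x' t) (l • x' t + (x' t + t • x'' t))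
      + l * (α - 1 - l) * inner ℝ (x t - xbar) (x' t)) ht₀ hκ0
    (by
      intro t ht
      have hf : HasDerivAt (fun s => f (x s)) (inner ℝ (f' (x t)) (x' t)) t := by
        simpa [Function.comp_def] using
          (hgrad (x t)).hasFDerivAt.comp_hasDerivAt t (hx1 t ht)
      have ha : HasDerivAt (fun s => x s - xbar) (x' t) t := (hx1 t ht).sub_const xbar
      have hv : HasDerivAt (fun s => l • (x s - xbar) + s • x' s)
          (l • x' t + (x' t + t • x'' t)) t := by
        have h := (ha.const_smul l).add ((hasDerivAt_id t).smul (hx2 t ht))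
        exact h.congr_deriv (by simp [add_comm (x' t)])
      have h := ((((hasDerivAt_pow 2 t).mul (hf.sub_const (f xbar))).add
        ((hx1 t ht).norm_sq.const_mul (c / 2))).add (hv.norm_sq.const_mul (1 / 2))).add
        (ha.norm_sq.const_mul (l * (α - 1 - l) / 2))
      refine h.congr_deriv ?_
      push_cast
      ring)
    (by
      intro t ht
      have h := lyapunov_decay (a := x t - xbar) (z := xbar) (p := x' t) (q := x'' t)
        (g := f' (x t)) (φ := f (x t) - f xbar) (ht₀.trans_le ht) hc hl0
        (sub_nonneg.2 (hmin _)) hκ0.le hκ1 (by linarith) hκ3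
        (hconv.sub_le_inner_of_hasGradientAt (hgrad (x t)) xbar)
        (by simpa using hode t ht)
      simpa only [sub_add_cancel] using h)
  have hparts : ∀ t, t₀ ≤ t → t ^ 2 * (f (x t) - f xbar) ≤ K ∧ c / 2 * ‖x t‖ ^ 2 ≤ K ∧
      1 / 2 * ‖l • (x t - xbar) + t • x' t‖ ^ 2 ≤ K ∧
      l * (α - 1 - l) / 2 * ‖x t - xbar‖ ^ 2 ≤ K := by
    intro t ht
    have h := hEK t ht
    have h1 : 0 ≤ t ^ 2 * (f (x t) - f xbar) :=
      mul_nonneg (sq_nonneg t) (sub_nonneg.2 (hmin _))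
    have h2 : 0 ≤ c / 2 * ‖x t‖ ^ 2 := by positivity
    have h3 : 0 ≤ 1 / 2 * ‖l • (x t - xbar) + t • x' t‖ ^ 2 := by positivity
    have h4 : 0 ≤ l * (α - 1 - l) / 2 * ‖x t - xbar‖ ^ 2 := by positivity
    refine ⟨?_, ?_, ?_, ?_⟩ <;> linarith
  refine ⟨⟨K, hK, t₀, le_rfl, fun t ht => ?_⟩, ?_, ?_⟩
  · have htpos : 0 < t := ht₀.trans_le ht
    rw [le_div_iff₀ (by positivity), mul_comm]
    exact (hparts t ht).1
  · rw [isBounded_iff_forall_norm_le]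
    refine ⟨√(2 * K / c), ?_⟩
    rintro _ ⟨t, ht, rfl⟩
    apply Real.le_sqrt_of_sq_le
    rw [le_div_iff₀ hc]
    linarith [(hparts t ht).2.1]
  · refine ⟨√(2 * K) + l * √(2 * K / (l * (α - 1 - l))), by positivity, t₀, le_rfl,
      fun t ht => ?_⟩
    have htpos : 0 < t := ht₀.trans_le ht
    obtain ⟨-, -, h3, h4⟩ := hparts t ht
    have hv : ‖l • (x t - xbar) + t • x' t‖ ≤ √(2 * K) :=
      Real.le_sqrt_of_sq_le (by linarith)
    have ha : ‖x t - xbar‖ ≤ √(2 * K / (l * (α - 1 - l))) := by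
      apply Real.le_sqrt_of_sq_le
      rw [le_div_iff₀ hξ]
      linarith
    rw [le_div_iff₀ htpos]
    calc ‖x' t‖ * t = ‖(l • (x t - xbar) + t • x' t) - l • (x t - xbar)‖ := by
          rw [add_sub_cancel_left, norm_smul, Real.norm_of_nonneg htpos.le, mul_comm]
      _ ≤ ‖l • (x t - xbar) + t • x' t‖ + ‖l • (x t - xbar)‖ := norm_sub_le _ _
      _ ≤ √(2 * K) + l * √(2 * K / (l * (α - 1 - l))) := by
          rw [norm_smul, Real.norm_of_nonneg hl0.le]
          gcongr
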